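/- Let X be a topological space, Y a T1 regular topological space, and F : X → Set Y a set-valued map. The following are equivalent: (1) F is a minimal usco map; (2) there exist a dense subset A of X and a function f : A → Y that is quasicontinuous on A (with the subspace topology), subcontinuous at every point of X, satisfies f a ∈ F a for every a ∈ A, and whose closure-of-graph map equals F (i.e. for every x ∈ X, F x = {y : (x,y) ∈ closure {(a, f a) : a ∈ A}}). -/

import Mathlib

open Filter Set Topology

section Defs

variable {X Y : Type*}

/-- `F` is upper semicontinuous at `x` (as a set-valued map). -/
def UscoAt [TopologicalSpace X] [TopologicalSpace Y] (F : X → Set Y) (x : X) : Prop :=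
  ∀ V : Set Y, IsOpen V → F x ⊆ V → ∃ U ∈ 𝓝 x, ∀ u ∈ U, F u ⊆ V

/-- `F` is usco: upper semicontinuous everywhere with nonempty compact values. -/
def IsUsco [TopologicalSpace X] [TopologicalSpace Y] (F : X → Set Y) : Prop :=
  (∀ x, (F x).Nonempty) ∧ (∀ x, IsCompact (F x)) ∧ (∀ x, UscoAt F x)

/-- `F` is a minimal usco map. -/
def IsMinimalUsco [TopologicalSpace X] [TopologicalSpace Y] (F : X → Set Y) : Prop :=
  IsUsco F ∧ ∀ G : X → Set Y, IsUsco G → (∀ x, G x ⊆ F x) → G = F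

/-- `F` is cusco: usco with convex values. -/
def IsCusco [TopologicalSpace X] [TopologicalSpace Y] [AddCommGroup Y] [Module ℝ Y]
    (F : X → Set Y) : Prop :=
  IsUsco F ∧ ∀ x, Convex ℝ (F x)

/-- `F` is a minimal cusco map. -/
def IsMinimalCusco [TopologicalSpace X] [TopologicalSpace Y] [AddCommGroup Y] [Module ℝ Y]
    (F : X → Set Y) : Prop :=
  IsCusco F ∧ ∀ G : X → Set Y, IsCusco G → (∀ x, G x ⊆ F x) → G = F

/-- `f` is quasicontinuous at `x`. -/
def QuasicontinuousAt [TopologicalSpace X] [TopologicalSpace Y] (f : X → Y) (x : X) : Prop :=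
  ∀ V : Set Y, IsOpen V → f x ∈ V → ∀ U : Set X, IsOpen U → x ∈ U →
    ∃ G : Set X, IsOpen G ∧ G.Nonempty ∧ G ⊆ U ∧ f '' G ⊆ V

/-- `f` is quasicontinuous. -/
def Quasicontinuous [TopologicalSpace X] [TopologicalSpace Y] (f : X → Y) : Prop :=
  ∀ x, QuasicontinuousAt f x

/-- `f` is subcontinuous at `x`: the image of every ultrafilter converging to `x` converges. -/
def SubcontinuousAt [TopologicalSpace X] [TopologicalSpace Y] (f : X → Y) (x : X) : Prop :=
  ∀ 𝔘 : Ultrafilter X, (𝔘 : Filter X) ≤ 𝓝 x → ∃ y : Y, Tendsto f 𝔘 (𝓝 y)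

/-- `f` is subcontinuous. -/
def Subcontinuous [TopologicalSpace X] [TopologicalSpace Y] (f : X → Y) : Prop :=
  ∀ x, SubcontinuousAt f x

/-- The closure-of-graph map of `f` : the value at `x` is the vertical section at `x`
of the closure of the graph of `f`. -/
def graphCl [TopologicalSpace X] [TopologicalSpace Y] (f : X → Y) (x : X) : Set Y :=
  {y | (x, y) ∈ closure {p : X × Y | p.2 = f p.1}}

/-- `f` is hyperplane minimal. -/
def HyperplaneMinimal [TopologicalSpace X] [TopologicalSpace Y] [AddCommGroup Y] [Module ℝ Y]
    (f : X → Y) : Prop :=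
  ∀ (l : Y →L[ℝ] ℝ) (lam : ℝ) (U : Set X), IsOpen U → U.Nonempty →
    (f '' U ∩ {y : Y | lam < l y}).Nonempty →
    ∃ V : Set X, IsOpen V ∧ V.Nonempty ∧ V ⊆ U ∧ f '' V ⊆ {y : Y | lam < l y}

/-- A densely defined `f : A → Y` is subcontinuous at `x ∈ X`: the image of every ultrafilter
on `A` converging to `x` in `X` converges in `Y`. -/
def DSubcontinuousAt [TopologicalSpace X] [TopologicalSpace Y] (A : Set X) (f : A → Y)
    (x : X) : Prop :=
  ∀ 𝔘 : Ultrafilter A, Tendsto (Subtype.val : A → X) 𝔘 (𝓝 x) → ∃ y : Y, Tendsto f 𝔘 (𝓝 y)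

/-- The closure-of-graph map of a densely defined function `f : A → Y`. -/
def dGraphCl [TopologicalSpace X] [TopologicalSpace Y] (A : Set X) (f : A → Y) (x : X) : Set Y :=
  {y | (x, y) ∈ closure {p : X × Y | ∃ a : A, p = ((a : X), f a)}}

/-- A densely defined `f : A → Y` is hyperplane minimal. -/
def DHyperplaneMinimal [TopologicalSpace X] [TopologicalSpace Y] [AddCommGroup Y] [Module ℝ Y]
    (A : Set X) (f : A → Y) : Prop :=
  ∀ (l : Y →L[ℝ] ℝ) (lam : ℝ) (U : Set X), IsOpen U →
    (f '' ((Subtype.val : A → X) ⁻¹' U) ∩ {y : Y | lam < l y}).Nonempty →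
    ∃ V : Set X, IsOpen V ∧ V.Nonempty ∧ V ⊆ U ∧
      f '' ((Subtype.val : A → X) ⁻¹' V) ⊆ {y : Y | lam < l y}

end Defs

theorem IsUsco.inter_isClosed {X Y : Type*} [TopologicalSpace X] [TopologicalSpace Y]
    {F : X → Set Y} (hF : IsUsco F) {C : Set (X × Y)} (hC : IsClosed C)
    (hne : ∀ x, (F x ∩ {y | (x, y) ∈ C}).Nonempty) :
    IsUsco fun x => F x ∩ {y | (x, y) ∈ C} := by
  refine ⟨hne, fun x => (hF.2.1 x).inter_right (hC.preimage (Continuous.prodMk_right x)), ?_⟩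
  intro x V hV hsub
  have hdisj : ({x} : Set X) ×ˢ (F x \ V) ⊆ Cᶜ := by
    rintro ⟨a, y⟩ ⟨rfl, hyF, hyV⟩ hyC
    exact hyV (hsub ⟨hyF, hyC⟩)
  obtain ⟨U, W, hU, hW, hxU, hFW, hUW⟩ := generalized_tube_lemma isCompact_singleton
    ((hF.2.1 x).diff hV) hC.isOpen_compl hdisj
  obtain ⟨U', hU', hFU'⟩ := hF.2.2 x (V ∪ W) (hV.union hW) fun y hy => by
    by_cases h : y ∈ V
    · exact Or.inl h
    · exact Or.inr (hFW ⟨hy, h⟩)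
  refine ⟨U ∩ U', inter_mem (hU.mem_nhds (hxU rfl)) hU', ?_⟩
  rintro u ⟨huU, huU'⟩ y ⟨hyF, hyC⟩
  exact (hFU' u huU' hyF).resolve_right fun hyW => hUW (mk_mem_prod huU hyW) hyC

theorem IsMinimalUsco.mem_of_isClosed {X Y : Type*} [TopologicalSpace X] [TopologicalSpace Y]
    {F : X → Set Y} (hF : IsMinimalUsco F) {C : Set (X × Y)} (hC : IsClosed C)
    (hne : ∀ x, (F x ∩ {y | (x, y) ∈ C}).Nonempty) {x : X} {y : Y} (hy : y ∈ F x) :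
    (x, y) ∈ C := by
  have h := hF.2 _ (hF.1.inter_isClosed hC hne) fun _ => inter_subset_left
  rw [← h] at hy
  exact hy.2

theorem IsUsco.isClosed_graph {X Y : Type*} [TopologicalSpace X] [TopologicalSpace Y]
    [T2Space Y] {F : X → Set Y} (hF : IsUsco F) : IsClosed {p : X × Y | p.2 ∈ F p.1} := by
  rw [← isOpen_compl_iff, isOpen_iff_mem_nhds]
  rintro ⟨x, y⟩ hxy
  obtain ⟨V, W, hV, hW, hFV, hyW, hVW⟩ :=
    SeparatedNhds.of_isCompact_isCompact (hF.2.1 x) (isCompact_singleton (x := y))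
      (disjoint_singleton_right.2 hxy)
  obtain ⟨U, hU, hFU⟩ := hF.2.2 x V hV hFV
  filter_upwards [prod_mem_nhds hU (hW.mem_nhds (hyW rfl))]
  rintro ⟨u, z⟩ ⟨hu, hz⟩ hzF
  exact hVW.le_bot ⟨hFU u hu hzF, hz⟩

theorem IsCompact.exists_le_nhds_of_isOpen_mem {Y : Type*} [TopologicalSpace Y] {K : Set Y}
    (hK : IsCompact K) (l : Ultrafilter Y) (h : ∀ V, IsOpen V → K ⊆ V → V ∈ l) :
    ∃ y ∈ K, (l : Filter Y) ≤ 𝓝 y := by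
  by_contra! hcon
  have hnhds : ∀ y ∈ K, ∃ V, y ∈ V ∧ IsOpen V ∧ V ∉ l := by
    intro y hy
    have hy' := hcon y hy
    rw [(nhds_basis_opens y).ge_iff] at hy'
    push Not at hy'
    obtain ⟨V, ⟨hyV, hV⟩, hVl⟩ := hy'
    exact ⟨V, hyV, hV, hVl⟩
  choose! V hyV hV hVl using hnhds
  obtain ⟨t, htK, hcover⟩ := hK.elim_nhds_subcover V fun y hy => (hV y hy).mem_nhds (hyV y hy)
  have hmem := h _ (isOpen_biUnion fun y hy => hV y (htK y hy)) hcover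
  obtain ⟨y, hy, hyl⟩ := (Ultrafilter.finite_biUnion_mem_iff t.finite_toSet).1 hmem
  exact hVl y (htK y hy) hyl

theorem IsUsco.dSubcontinuousAt {X Y : Type*} [TopologicalSpace X] [TopologicalSpace Y]
    {F : X → Set Y} (hF : IsUsco F) {A : Set X} {f : A → Y} (hf : ∀ a : A, f a ∈ F a) (x : X) :
    DSubcontinuousAt A f x := by
  intro l hl
  obtain ⟨y, -, hy⟩ := (hF.2.1 x).exists_le_nhds_of_isOpen_mem (l.map f) fun V hV hFV => by
    obtain ⟨U, hU, hFU⟩ := hF.2.2 x V hV hFV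
    exact Ultrafilter.mem_map.2 (mem_of_superset (hl hU) fun a ha => hFU a ha (hf a))
  exact ⟨y, hy⟩

theorem IsMinimalUsco.quasicontinuous {X Y : Type*} [TopologicalSpace X] [TopologicalSpace Y]
    {F : X → Set Y} (hF : IsMinimalUsco F) {A : Set X} (hA : Dense A) {f : A → Y}
    (hf : ∀ a : A, f a ∈ F a) : Quasicontinuous f := by
  intro a V hV haV U hU haU
  obtain ⟨O, hO, rfl⟩ := isOpen_induced_iff.1 hU
  by_contra! hcon
  refine hF.mem_of_isClosed (hO.prod hV).isClosed_compl (fun u => ?_) (hf a)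
    (mk_mem_prod haU haV)
  by_contra hemp
  have hsub : ∀ y ∈ F u, u ∈ O ∧ y ∈ V := by
    intro y hy
    by_contra h
    exact hemp ⟨y, hy, h⟩
  obtain ⟨y, hy⟩ := hF.1.1 u
  obtain ⟨N, hN, hFN⟩ := hF.1.2.2 u V hV fun y hy => (hsub y hy).2
  obtain ⟨N', hN'N, hN', huN'⟩ := mem_nhds_iff.1 hN
  obtain ⟨b, ⟨hbO, hbN'⟩, hbA⟩ :=
    hA.inter_open_nonempty (O ∩ N') (hO.inter hN') ⟨u, (hsub y hy).1, huN'⟩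
  refine hcon (Subtype.val ⁻¹' (O ∩ N')) ((hO.inter hN').preimage continuous_subtype_val)
    ⟨⟨b, hbA⟩, hbO, hbN'⟩ (fun c hc => hc.1) ?_
  rintro _ ⟨c, hc, rfl⟩
  exact hFN c (hN'N hc.2) (hf c)

theorem mem_dGraphCl_of_tendsto {X Y : Type*} [TopologicalSpace X] [TopologicalSpace Y]
    {A : Set X} {f : A → Y} {l : Filter A} [l.NeBot] {x : X} {y : Y}
    (hx : Tendsto (Subtype.val : A → X) l (𝓝 x)) (hy : Tendsto f l (𝓝 y)) :
    y ∈ dGraphCl A f x :=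
  mem_closure_of_tendsto (hx.prodMk_nhds hy) (Eventually.of_forall fun a => ⟨a, rfl⟩)

theorem exists_mem_of_mem_dGraphCl {X Y : Type*} [TopologicalSpace X] [TopologicalSpace Y]
    {A : Set X} {f : A → Y} {x : X} {y : Y} (hy : y ∈ dGraphCl A f x) {s : Set (X × Y)}
    (hs : s ∈ 𝓝 (x, y)) : ∃ a : A, ((a : X), f a) ∈ s := by
  obtain ⟨_, hp, a, rfl⟩ := mem_closure_iff_nhds.1 hy s hs
  exact ⟨a, hp⟩

theorem nonempty_dGraphCl {X Y : Type*} [TopologicalSpace X] [TopologicalSpace Y]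
    {A : Set X} (hA : Dense A) {f : A → Y} {x : X} (hf : DSubcontinuousAt A f x) :
    (dGraphCl A f x).Nonempty := by
  have : (comap (Subtype.val : A → X) (𝓝 x)).NeBot :=
    mem_closure_iff_comap_neBot.1 (hA x)
  let l := Ultrafilter.of (comap (Subtype.val : A → X) (𝓝 x))
  have hl : Tendsto (Subtype.val : A → X) l (𝓝 x) :=
    tendsto_comap.mono_left (Ultrafilter.of_le _)
  obtain ⟨y, hy⟩ := hf _ hl
  exact ⟨y, mem_dGraphCl_of_tendsto hl hy⟩

theorem IsMinimalUsco.dGraphCl_eq {X Y : Type*} [TopologicalSpace X] [TopologicalSpace Y]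
    [T2Space Y] {F : X → Set Y} (hF : IsMinimalUsco F) {A : Set X} (hA : Dense A) {f : A → Y}
    (hf : ∀ a : A, f a ∈ F a) (x : X) : dGraphCl A f x = F x := by
  have hsub : ∀ x, dGraphCl A f x ⊆ F x := fun x y hy =>
    closure_minimal (by rintro _ ⟨a, rfl⟩; exact hf a) hF.1.isClosed_graph hy
  refine (hsub x).antisymm fun y hy => hF.mem_of_isClosed isClosed_closure (fun u => ?_) hy
  obtain ⟨z, hz⟩ := nonempty_dGraphCl hA (hF.1.dSubcontinuousAt hf u)
  exact ⟨z, hsub u hz, hz⟩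

theorem DSubcontinuousAt.isCompact_dGraphCl {X Y : Type*} [TopologicalSpace X]
    [TopologicalSpace Y] [RegularSpace Y] {A : Set X} {f : A → Y} {x : X}
    (hf : DSubcontinuousAt A f x) : IsCompact (dGraphCl A f x) := by
  rw [isCompact_iff_ultrafilter_le_nhds']
  intro v hv
  -- `v.bind 𝓝` is the filter generated by the open members of `v`.
  let L : Filter A :=
    comap (fun a : A => ((a : X), f a)) (bind (v : Filter Y) fun y => 𝓝 (x, y))
  have : L.NeBot := by
    refine comap_neBot fun s hs => ?_
    obtain ⟨y, hys, hy⟩ := v.nonempty_of_mem (inter_mem (mem_bind'.1 hs) hv)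
    exact exists_mem_of_mem_dGraphCl hy hys
  have hL : Tendsto (fun a : A => ((a : X), f a)) (Ultrafilter.of L)
      (bind (v : Filter Y) fun y => 𝓝 (x, y)) :=
    tendsto_comap.mono_left (Ultrafilter.of_le L)
  have hx : Tendsto (Subtype.val : A → X) (Ultrafilter.of L) (𝓝 x) := fun s hs =>
    hL (mem_bind'.2 (Eventually.of_forall fun y => continuous_fst.continuousAt hs))
  obtain ⟨y, hy⟩ := hf _ hx
  refine ⟨y, mem_dGraphCl_of_tendsto hx hy, ?_⟩
  rw [(closed_nhds_basis y).ge_iff]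
  rintro N ⟨hyN, hN⟩
  by_contra hNv
  have hfar : f ⁻¹' Nᶜ ∈ Ultrafilter.of L := by
    have hmem : Prod.snd ⁻¹' Nᶜ ∈ bind (v : Filter Y) fun y => 𝓝 (x, y) :=
      mem_bind'.2 <| mem_of_superset (Ultrafilter.compl_mem_iff_notMem.2 hNv) fun z hz =>
        continuous_snd.continuousAt (hN.isOpen_compl.mem_nhds hz)
    exact hL hmem
  obtain ⟨a, ha, haN⟩ := (Ultrafilter.of L).nonempty_of_mem (inter_mem hfar (hy hyN))
  exact ha haN

theorem DSubcontinuousAt.eventually_mem {X Y : Type*} [TopologicalSpace X] [TopologicalSpace Y]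
    {A : Set X} {f : A → Y} {x : X} (hf : DSubcontinuousAt A f x) {V : Set Y} (hV : IsOpen V)
    (hsub : dGraphCl A f x ⊆ V) : ∀ᶠ a in comap (Subtype.val : A → X) (𝓝 x), f a ∈ V := by
  rw [Filter.Eventually, mem_iff_ultrafilter]
  intro l hl
  have hx : Tendsto (Subtype.val : A → X) l (𝓝 x) := tendsto_iff_comap.2 hl
  obtain ⟨y, hy⟩ := hf l hx
  exact hy (hV.mem_nhds (hsub (mem_dGraphCl_of_tendsto hx hy)))

theorem dGraphCl_subset_closure {X Y : Type*} [TopologicalSpace X] [TopologicalSpace Y]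
    {A : Set X} {f : A → Y} {U : Set X} (hU : IsOpen U) {V : Set Y}
    (hf : ∀ a : A, (a : X) ∈ U → f a ∈ V) {u : X} (hu : u ∈ U) :
    dGraphCl A f u ⊆ closure V := by
  intro y hy
  rw [mem_closure_iff_nhds]
  intro t ht
  obtain ⟨a, haU, hat⟩ := exists_mem_of_mem_dGraphCl hy (prod_mem_nhds (hU.mem_nhds hu) ht)
  exact ⟨f a, hat, hf a haU⟩

theorem isUsco_dGraphCl {X Y : Type*} [TopologicalSpace X] [TopologicalSpace Y]
    [RegularSpace Y] {A : Set X} (hA : Dense A) {f : A → Y} (hf : ∀ x, DSubcontinuousAt A f x) :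
    IsUsco (dGraphCl A f) := by
  refine ⟨fun x => nonempty_dGraphCl hA (hf x), fun x => (hf x).isCompact_dGraphCl, ?_⟩
  intro x V hV hsub
  obtain ⟨W, hW, hFW, hWV⟩ :=
    (hf x).isCompact_dGraphCl.exists_isOpen_closure_subset (hV.mem_nhdsSet.2 hsub)
  obtain ⟨U, hU, hUW⟩ := mem_comap.1 ((hf x).eventually_mem hW hFW)
  obtain ⟨O, hOU, hO, hxO⟩ := mem_nhds_iff.1 hU
  exact ⟨O, hO.mem_nhds hxO, fun u hu =>
    (dGraphCl_subset_closure (f := f) hO (fun a ha => hUW (hOU ha)) hu).trans hWV⟩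

theorem Quasicontinuous.isMinimalUsco_dGraphCl {X Y : Type*} [TopologicalSpace X]
    [TopologicalSpace Y] [T3Space Y] {A : Set X} (hA : Dense A) {f : A → Y}
    (hq : Quasicontinuous f) (hf : ∀ x, DSubcontinuousAt A f x) :
    IsMinimalUsco (dGraphCl A f) := by
  refine ⟨isUsco_dGraphCl hA hf, fun G hG hGF => funext fun x => (hGF x).antisymm ?_⟩
  intro y hy
  by_contra hyG
  obtain ⟨W, V, hW, hV, hGW, hyV, hWV⟩ :=
    SeparatedNhds.of_isCompact_isCompact (hG.2.1 x) (isCompact_singleton (x := y))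
      (disjoint_singleton_right.2 hyG)
  obtain ⟨U, hU, hGU⟩ := hG.2.2 x W hW hGW
  obtain ⟨O, hOU, hO, hxO⟩ := mem_nhds_iff.1 hU
  obtain ⟨a, haO, haV⟩ := exists_mem_of_mem_dGraphCl hy
    (prod_mem_nhds (hO.mem_nhds hxO) (hV.mem_nhds (hyV rfl)))
  obtain ⟨P, hP, ⟨b, hb⟩, hPO, hPV⟩ :=
    hq a V hV haV _ (hO.preimage continuous_subtype_val) haO
  obtain ⟨Q, hQ, rfl⟩ := isOpen_induced_iff.1 hP
  obtain ⟨z, hz⟩ := hG.1 b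
  have hzV : z ∈ closure V :=
    dGraphCl_subset_closure hQ (fun c hc => hPV (mem_image_of_mem f hc)) hb (hGF b hz)
  exact (hWV.closure_right hW).le_bot ⟨hGU b (hOU (hPO hb)) hz, hzV⟩

variable {X Y : Type*} [TopologicalSpace X] [TopologicalSpace Y]
variable [T1Space Y] [RegularSpace Y]

theorem stmt9 (F : X → Set Y) :
    IsMinimalUsco F ↔
      ∃ (A : Set X), Dense A ∧ ∃ f : A → Y, Quasicontinuous f ∧
        (∀ x, DSubcontinuousAt A f x) ∧ (∀ a : A, f a ∈ F a) ∧
        (∀ x, dGraphCl A f x = F x) := by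
  constructor
  · intro hF
    choose g hg using hF.1.1
    have hf : ∀ a : (univ : Set X), g a ∈ F a := fun a => hg a
    exact ⟨univ, dense_univ, fun a => g a, hF.quasicontinuous dense_univ hf,
      hF.1.dSubcontinuousAt hf, hf, hF.dGraphCl_eq dense_univ hf⟩
  · rintro ⟨A, hA, f, hq, hf, -, hF⟩
    obtain rfl : dGraphCl A f = F := funext hF
    exact hq.isMinimalUsco_dGraphCl hA hf
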